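/- Let λ : ℕ → ℝ be a summable sequence with 0 ≤ λ_i ≤ 1 for all i, set S := Σ_{i∈ℕ} λ_i, and for each k ∈ ℕ set p_k := Σ_{I ⊆ ℕ finite, |I| = k} (Π_{i∈I} λ_i) · (Π_{j∉I} (1 − λ_j)). Then for every k ∈ ℕ, p_k ≤ (e·S)^k / k! · e^{−S}. -/

import Mathlib

/-- The elementary symmetric function of degree `k` of nonnegative reals is at most
`(∑ x) ^ k / k!`. -/
lemma sum_powersetCard_prod_le_pow_div_factorial {ι : Type*} [DecidableEq ι] {x : ι → ℝ}
    (hx : ∀ i, 0 ≤ x i) (T : Finset ι) (k : ℕ) :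
    ∑ I ∈ T.powersetCard k, ∏ i ∈ I, x i ≤ (∑ i ∈ T, x i) ^ k / (Nat.factorial k) := by
  induction T using Finset.induction_on generalizing k with
  | empty =>
    cases k with
    | zero => simp
    | succ k => simp [Finset.powersetCard_eq_empty.2 (show (∅ : Finset ι).card < k + 1 by simp)]
  | insert a T ha ih =>
    cases k with
    | zero => simp
    | succ k =>
      have hinsert : ∑ I ∈ (T.powersetCard k).image (insert a), ∏ i ∈ I, x i =
          x a * ∑ I ∈ T.powersetCard k, ∏ i ∈ I, x i := by
        have hnot : ∀ I ∈ T.powersetCard k, a ∉ I := fun I hI h =>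
          ha ((Finset.mem_powersetCard.1 hI).1 h)
        rw [Finset.sum_image, Finset.mul_sum]
        · exact Finset.sum_congr rfl fun I hI => Finset.prod_insert (hnot I hI)
        · intro I hI J hJ h
          rw [← Finset.erase_insert (hnot I hI), h, Finset.erase_insert (hnot J hJ)]
      rw [Finset.powersetCard_succ_insert ha, Finset.sum_union, hinsert, Finset.sum_insert ha]
      · have hT : 0 ≤ ∑ i ∈ T, x i := Finset.sum_nonneg fun i _ => hx i
        have hpow : ∀ (s : ℝ), 0 ≤ s → ∀ n : ℕ,
            s ^ (n + 1) + (n + 1) * x a * s ^ n ≤ (x a + s) ^ (n + 1) := by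
          intro s hs n
          induction n with
          | zero => simp [add_comm]
          | succ n ihn =>
            have h1 := mul_le_mul_of_nonneg_left ihn (add_nonneg (hx a) hs)
            have h2 : 0 ≤ (n + 1) * (x a) ^ 2 * s ^ n := by positivity
            push_cast
            rw [pow_succ' (x a + s)]
            refine le_trans ?_ h1
            ring_nf at h2 ⊢
            linarith
        calc _ ≤ (∑ i ∈ T, x i) ^ (k + 1) / (Nat.factorial (k + 1)) +
              x a * ((∑ i ∈ T, x i) ^ k / (Nat.factorial k)) :=
              add_le_add (ih _) (mul_le_mul_of_nonneg_left (ih _) (hx a))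
          _ = ((∑ i ∈ T, x i) ^ (k + 1) + (k + 1) * x a * (∑ i ∈ T, x i) ^ k) /
              (Nat.factorial (k + 1)) := by
              have := Nat.factorial_pos k
              rw [Nat.factorial_succ]
              push_cast
              field_simp
          _ ≤ _ := by gcongr; exact hpow _ hT k
      · rw [Finset.disjoint_left]
        intro I hI hI'
        obtain ⟨J, -, rfl⟩ := Finset.mem_image.1 hI'
        exact ha ((Finset.mem_powersetCard.1 hI).1 (Finset.mem_insert_self a J))

/-- An infinite product of factors `1 - x i` in `[0, ∞)` is at most `exp (-∑ x)`. -/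
lemma tprod_one_sub_nonneg_and_le_exp {ι : Type*} {x : ι → ℝ} (hx : Summable x)
    (h1 : ∀ i, x i ≤ 1) :
    0 ≤ ∏' i, (1 - x i) ∧ ∏' i, (1 - x i) ≤ Real.exp (-∑' i, x i) := by
  have hprod : Multipliable fun i => 1 - x i := by
    simpa [sub_eq_add_neg] using multipliable_one_add_of_summable (f := fun i => -x i)
      hx.neg.norm
  have hexp := (Real.continuous_exp.tendsto _).comp hx.hasSum.neg
  refine ⟨ge_of_tendsto' hprod.hasProd fun s => Finset.prod_nonneg fun i _ => by
    linarith [h1 i], le_of_tendsto_of_tendsto' hprod.hasProd hexp fun s => ?_⟩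
  simp only [Function.comp, Real.exp_sum]
  exact Finset.prod_le_prod (fun i _ => by linarith [h1 i]) fun i _ => Real.one_sub_le_exp_neg _


/-- For a summable sequence `λ : ℕ → [0,1]` with `S = ∑ λ i` and
`p k = ∑_{I ⊆ ℕ finite, |I| = k} (∏_{i ∈ I} λ i) (∏_{j ∉ I} (1 - λ j))`,
one has `p k ≤ (e S) ^ k / k! * exp (-S)` for every `k`. -/
theorem stmt2 (lam : ℕ → ℝ) (hsum : Summable lam)
    (hlam : ∀ i, 0 ≤ lam i ∧ lam i ≤ 1) (S : ℝ) (hS : S = ∑' i, lam i) (p : ℕ → ℝ)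
    (hp : ∀ k, p k =
      ∑' I : {s : Finset ℕ // s.card = k},
        (∏ i ∈ (I : Finset ℕ), lam i) *
          (∏' j : {j : ℕ // j ∉ (I : Finset ℕ)}, (1 - lam (j : ℕ))))
    (k : ℕ) :
    p k ≤ (Real.exp 1 * S) ^ k / (Nat.factorial k) * Real.exp (-S) := by
  have hterm (I : {s : Finset ℕ // s.card = k}) :
      0 ≤ (∏ i ∈ (I : Finset ℕ), lam i) *
          (∏' j : {j : ℕ // j ∉ (I : Finset ℕ)}, (1 - lam (j : ℕ))) ∧
      (∏ i ∈ (I : Finset ℕ), lam i) *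
          (∏' j : {j : ℕ // j ∉ (I : Finset ℕ)}, (1 - lam (j : ℕ))) ≤
        (∏ i ∈ (I : Finset ℕ), lam i) * (Real.exp 1 ^ k * Real.exp (-S)) := by
    obtain ⟨I, rfl⟩ := I
    have hI : 0 ≤ ∏ i ∈ I, lam i := Finset.prod_nonneg fun i _ => (hlam i).1
    obtain ⟨h0, hle⟩ := tprod_one_sub_nonneg_and_le_exp
      (x := fun j : {j : ℕ // j ∉ I} => lam j) (hsum.subtype _) fun j => (hlam j).2
    refine ⟨mul_nonneg hI h0, mul_le_mul_of_nonneg_left (hle.trans ?_) hI⟩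
    have hsplit : ∑ i ∈ I, lam i + ∑' j : {j : ℕ // j ∉ I}, lam j = S :=
      (hsum.sum_add_tsum_subtype_compl I).trans hS.symm
    have hcard : ∑ i ∈ I, lam i ≤ I.card := by
      simpa using Finset.sum_le_sum (s := I) fun i _ => (hlam i).2
    rw [← Real.exp_nat_mul, ← Real.exp_add]
    exact Real.exp_le_exp.2 (by linarith)
  rw [hp]
  refine Real.tsum_le_of_sum_le (fun I => (hterm I).1) fun F => ?_
  set T : Finset ℕ := F.biUnion fun I => I
  have hsub : F.map (Function.Embedding.subtype _) ⊆ T.powersetCard k := by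
    intro I hI
    obtain ⟨J, hJ, rfl⟩ := Finset.mem_map.1 hI
    exact Finset.mem_powersetCard.2
      ⟨Finset.subset_biUnion_of_mem (fun I : {s : Finset ℕ // s.card = k} => (I : Finset ℕ)) hJ,
        J.2⟩
  have hprod : ∑ I ∈ F, ∏ i ∈ (I : Finset ℕ), lam i ≤ S ^ k / (Nat.factorial k) := by
    calc ∑ I ∈ F, ∏ i ∈ (I : Finset ℕ), lam i
        = ∑ I ∈ F.map (Function.Embedding.subtype _), ∏ i ∈ I, lam i := by simp
      _ ≤ ∑ I ∈ T.powersetCard k, ∏ i ∈ I, lam i :=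
        Finset.sum_le_sum_of_subset_of_nonneg hsub fun I _ _ =>
          Finset.prod_nonneg fun i _ => (hlam i).1
      _ ≤ (∑ i ∈ T, lam i) ^ k / (Nat.factorial k) :=
        sum_powersetCard_prod_le_pow_div_factorial (fun i => (hlam i).1) T k
      _ ≤ S ^ k / (Nat.factorial k) := by
        have hT : ∑ i ∈ T, lam i ≤ S := hS ▸ hsum.sum_le_tsum T fun i _ => (hlam i).1
        have := Finset.sum_nonneg fun i (_ : i ∈ T) => (hlam i).1
        gcongr
  calc _ ≤ ∑ I ∈ F, (∏ i ∈ (I : Finset ℕ), lam i) * (Real.exp 1 ^ k * Real.exp (-S)) :=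
        Finset.sum_le_sum fun I _ => (hterm I).2
    _ = (∑ I ∈ F, ∏ i ∈ (I : Finset ℕ), lam i) * (Real.exp 1 ^ k * Real.exp (-S)) :=
        (Finset.sum_mul ..).symm
    _ ≤ S ^ k / (Nat.factorial k) * (Real.exp 1 ^ k * Real.exp (-S)) := by gcongr
    _ = _ := by rw [mul_pow]; ring
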